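/- There exist sets B₀, B₁ ⊆ ℕ that form a maximal pair in the infinite-information degrees: there is no set A ⊆ ℕ such that both B₀ is infinite-information reducible to A and B₁ is infinite-information reducible to A. -/

import Mathlib

open Filter

/-- A finite record of oracle query answers: a finite list of (position, bit) pairs. -/
abbrev FinInfo : Type := List (ℕ × Bool)

/-- Two finite query-answer records are compatible if they agree wherever both answer. -/
def FinInfo.Compatible (σ τ : FinInfo) : Prop :=
  ∀ p ∈ σ, ∀ q ∈ τ, p.1 = q.1 → p.2 = q.2

/-- The answers recorded in `σ` are exactly those given by the characteristic
function of the set `C`. -/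
def AgreesSet (σ : FinInfo) (C : Set ℕ) : Prop :=
  ∀ p ∈ σ, (p.2 = true ↔ p.1 ∈ C)

/-- The answers recorded in `σ` are all given by the partial oracle `g`. -/
def AgreesPart (σ : FinInfo) (g : ℕ →. Bool) : Prop :=
  ∀ p ∈ σ, p.2 ∈ g p.1

/-- `g` is a partial oracle for the set `A`: a partial function from `ℕ` to `Bool`
agreeing with the characteristic function of `A` on its domain. -/
def IsPartialOracle (g : ℕ →. Bool) (A : Set ℕ) : Prop :=
  ∀ n b, b ∈ g n → (b = true ↔ n ∈ A)

/-- The domain of a partial oracle. -/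
def pDom (g : ℕ →. Bool) : Set ℕ := {n | (g n).Dom}

/-- A Turing functional (oracle Turing machine program), presented as a computable
enumeration of axioms `(σ, n, b)`, meaning: if the oracle answers the queries
recorded in `σ` as `σ` prescribes, then the machine halts on input `n` with
output `b`.  Oracle queries are made in parallel, so with a partial oracle the
machine halts on `n` iff some axiom for `n` is answered by the partial oracle.
Determinism of the machine is reflected in the requirement that axioms with
compatible query answers give equal outputs. -/
structure TuringFunctional where
  axs : ℕ → Option (FinInfo × ℕ × Bool)
  axs_computable : Computable axs
  consistent : ∀ k₁ k₂ σ₁ σ₂ n b₁ b₂, axs k₁ = some (σ₁, n, b₁) →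
    axs k₂ = some (σ₂, n, b₂) → σ₁.Compatible σ₂ → b₁ = b₂

namespace TuringFunctional

/-- `Φ^C(n)` halts with output `b` (total oracle `C`). -/
def HaltsT (Φ : TuringFunctional) (C : Set ℕ) (n : ℕ) (b : Bool) : Prop :=
  ∃ k σ, Φ.axs k = some (σ, n, b) ∧ AgreesSet σ C

/-- `Φ^g(n)` halts with output `b` (partial oracle `g`). -/
def HaltsP (Φ : TuringFunctional) (g : ℕ →. Bool) (n : ℕ) (b : Bool) : Prop :=
  ∃ k σ, Φ.axs k = some (σ, n, b) ∧ AgreesPart σ g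

/-- `Φ^C` is total. -/
def TotalOn (Φ : TuringFunctional) (C : Set ℕ) : Prop := ∀ n, ∃ b, Φ.HaltsT C n b

/-- The set `{n : Φ^C(n) = B(n)}` on which `Φ^C` halts and agrees with the
characteristic function of `B`. -/
def AgreeSet (Φ : TuringFunctional) (C B : Set ℕ) : Set ℕ :=
  {n | ∃ b, Φ.HaltsT C n b ∧ (b = true ↔ n ∈ B)}

/-- `Φ^A = B`: with oracle `A`, `Φ` is total and computes the characteristic
function of `B`. -/
def FunEq (Φ : TuringFunctional) (A B : Set ℕ) : Prop :=
  Φ.TotalOn A ∧ ∀ n b, Φ.HaltsT A n b → (b = true ↔ n ∈ B)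

/-- `Φ^g ≃ B`: every halting output of `Φ` with partial oracle `g` agrees with
the characteristic function of `B`. -/
def PAgrees (Φ : TuringFunctional) (g : ℕ →. Bool) (B : Set ℕ) : Prop :=
  ∀ n b, Φ.HaltsP g n b → (b = true ↔ n ∈ B)

/-- The domain of `Φ^g`. -/
def PDomain (Φ : TuringFunctional) (g : ℕ →. Bool) : Set ℕ :=
  {n | ∃ b, Φ.HaltsP g n b}

/-- The axiom with index `k` applies to oracle `C` on input `n`. -/
def AppliesAt (Φ : TuringFunctional) (C : Set ℕ) (n k : ℕ) : Prop :=
  ∃ σ b, Φ.axs k = some (σ, n, b) ∧ AgreesSet σ C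

/-- The (halting) computation of `Φ^C(n)` queries the oracle bit `C(m)`:
the first axiom in the enumeration that applies to `C` on input `n`
records an answer to a query at position `m`. -/
def QueriesAt (Φ : TuringFunctional) (C : Set ℕ) (n m : ℕ) : Prop :=
  ∃ k σ b, Φ.axs k = some (σ, n, b) ∧ AgreesSet σ C ∧
    (∀ k' < k, ¬ Φ.AppliesAt C n k') ∧ ∃ p ∈ σ, p.1 = m

end TuringFunctional

/-- `D ⊆ ℕ` has (asymptotic) density 1. -/
def DensityOne (D : Set ℕ) : Prop :=
  Filter.Tendsto (fun n : ℕ => ((D ∩ Set.Iio n).ncard : ℝ) / n) Filter.atTop (nhds 1)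

/-- `B ≤₁ A`: 1-reducibility. -/
def OneRed (B A : Set ℕ) : Prop :=
  ∃ f : ℕ → ℕ, Computable f ∧ Function.Injective f ∧ ∀ n, n ∈ B ↔ f n ∈ A

/-- `B ≤_T A`: Turing reducibility. -/
def TuringRed (B A : Set ℕ) : Prop :=
  ∃ Φ : TuringFunctional, Φ.FunEq A B

/-- `B ≤_mr A`: mod-recursive reducibility. -/
def ModRecRed (B A : Set ℕ) : Prop :=
  ∃ Φ : TuringFunctional, Φ.FunEq A B ∧
    ∀ C : Set ℕ, ComputablePred (fun n => (n ∈ C ↔ n ∈ A)) →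
      Φ.TotalOn C ∧ ComputablePred (fun n => n ∈ Φ.AgreeSet C B)

/-- `B ≤_mf A`: mod-finite reducibility. -/
def ModFinRed (B A : Set ℕ) : Prop :=
  ∃ Φ : TuringFunctional, Φ.FunEq A B ∧
    ∀ C : Set ℕ, {n | ¬ (n ∈ C ↔ n ∈ A)}.Finite →
      Φ.TotalOn C ∧ (Φ.AgreeSet C B)ᶜ.Finite

/-- `B ≤_cor A`: coarse reducibility. -/
def CoarseRed (B A : Set ℕ) : Prop :=
  ∃ Φ : TuringFunctional,
    ∀ C : Set ℕ, DensityOne {n | n ∈ C ↔ n ∈ A} →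
      Φ.TotalOn C ∧ DensityOne (Φ.AgreeSet C B)

/-- `B ≤_cf A`: cofinite reducibility. -/
def CofinRed (B A : Set ℕ) : Prop :=
  ∃ Φ : TuringFunctional, Φ.FunEq A B ∧
    ∀ g : ℕ →. Bool, IsPartialOracle g A → (pDom g)ᶜ.Finite →
      Φ.PAgrees g B ∧ (Φ.PDomain g)ᶜ.Finite

/-- `B ≤_g A`: generic reducibility. -/
def GenericRed (B A : Set ℕ) : Prop :=
  ∃ Φ : TuringFunctional, Φ.FunEq A B ∧
    ∀ g : ℕ →. Bool, IsPartialOracle g A → DensityOne (pDom g) →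
      Φ.PAgrees g B ∧ DensityOne (Φ.PDomain g)

/-- `B ≤_ii A`: infinite-information reducibility. -/
def IIRed (B A : Set ℕ) : Prop :=
  ∃ Φ : TuringFunctional,
    ∀ g : ℕ →. Bool, IsPartialOracle g A → (pDom g).Infinite →
      Φ.PAgrees g B ∧ (Φ.PDomain g).Infinite

/-- `B ≤_ubfb A`: use-bounded-from-below reducibility. -/
def UbfbRed (B A : Set ℕ) : Prop :=
  ∃ Φ : TuringFunctional, Φ.FunEq A B ∧
    ∀ m : ℕ, ∀ᶠ n in Filter.atTop, ¬ Φ.QueriesAt A n m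

/-- `R(S) = {2^n · m : n ∈ S, m odd}`. -/
def Rmap (S : Set ℕ) : Set ℕ :=
  {x | ∃ n ∈ S, ∃ m : ℕ, Odd m ∧ x = 2 ^ n * m}

/-- `R̃(S) = {2^n + m : n ∈ S, m < 2^n}`. -/
def Rtilde (S : Set ℕ) : Set ℕ :=
  {x | ∃ n ∈ S, ∃ m : ℕ, m < 2 ^ n ∧ x = 2 ^ n + m}

/-- The Turing join `A ⊕ B`. -/
def turingJoin (A B : Set ℕ) : Set ℕ :=
  {x | (∃ n ∈ A, x = 2 * n) ∨ (∃ n ∈ B, x = 2 * n + 1)}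

instance TuringFunctional.instCountable : Countable TuringFunctional := by
  refine Function.Injective.countable (β := {f : ℕ → ℕ // Computable f})
    (f := fun Φ => ⟨fun k => Encodable.encode (Φ.axs k),
      Computable.encode.comp Φ.axs_computable⟩) ?_
  rintro ⟨f, hf, hf'⟩ ⟨g, hg, hg'⟩ h
  have hfg : f = g := by
    funext k
    exact Encodable.encode_injective (congrFun (congrArg Subtype.val h) k)
  subst hfg
  rfl

/-- The partial oracle with domain `E` and constant answer `i`. -/
def constOracle (i : Bool) (E : Set ℕ) : ℕ →. Bool := fun n => ⟨n ∈ E, fun _ => i⟩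

theorem mem_constOracle {i b : Bool} {E : Set ℕ} {n : ℕ} :
    b ∈ constOracle i E n ↔ n ∈ E ∧ i = b :=
  ⟨fun ⟨h, h'⟩ => ⟨h, h'⟩, fun ⟨h, h'⟩ => ⟨h, h'⟩⟩

theorem isPartialOracle_constOracle {i : Bool} {E A : Set ℕ}
    (h : ∀ n ∈ E, (i = true ↔ n ∈ A)) : IsPartialOracle (constOracle i E) A := by
  intro n b hb
  obtain ⟨hn, rfl⟩ := mem_constOracle.1 hb
  exact h n hn

namespace TuringFunctional

theorem HaltsP.mono_constOracle {Φ : TuringFunctional} {i : Bool} {E E' : Set ℕ} {n : ℕ} {b : Bool}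
    (h : Φ.HaltsP (constOracle i E) n b) (hE : E ⊆ E') : Φ.HaltsP (constOracle i E') n b := by
  obtain ⟨k, σ, hk, hσ⟩ := h
  refine ⟨k, σ, hk, fun p hp => ?_⟩
  have := mem_constOracle.1 (hσ p hp)
  exact mem_constOracle.2 ⟨hE this.1, this.2⟩

theorem PDomain_constOracle_mono (Φ : TuringFunctional) {i : Bool} {E E' : Set ℕ} (hE : E ⊆ E') :
    Φ.PDomain (constOracle i E) ⊆ Φ.PDomain (constOracle i E') :=
  fun _ ⟨b, hb⟩ => ⟨b, hb.mono_constOracle hE⟩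

theorem HaltsP.unique_constOracle {Φ : TuringFunctional} {i : Bool} {E : Set ℕ} {n : ℕ}
    {b b' : Bool} (h : Φ.HaltsP (constOracle i E) n b) (h' : Φ.HaltsP (constOracle i E) n b') :
    b = b' := by
  obtain ⟨k, σ, hk, hσ⟩ := h
  obtain ⟨k', σ', hk', hσ'⟩ := h'
  refine Φ.consistent k k' σ σ' n b b' hk hk' fun p hp q hq _ => ?_
  exact (mem_constOracle.1 (hσ p hp)).2.symm.trans (mem_constOracle.1 (hσ' q hq)).2

/-- Some total function differs from every output of `Φ` on an oracle constantly `i`. -/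
theorem exists_avoiding (Φ : TuringFunctional) (i : Bool) :
    ∃ ψ : ℕ → Bool, ∀ E n b, Φ.HaltsP (constOracle i E) n b → ψ n ≠ b := by
  classical
  refine ⟨fun n => decide (¬ Φ.HaltsP (constOracle i Set.univ) n true), fun E n b h => ?_⟩
  have h := h.mono_constOracle (Set.subset_univ E)
  cases b
  · have : ¬ Φ.HaltsP (constOracle i Set.univ) n true := fun h' => by
      simpa using h.unique_constOracle h'
    simpa using this
  · simpa using h

end TuringFunctional

/-- A set of families of functions is dense if it is reached from every family by replacing
all values above some arbitrarily large bound by those of a fixed family. -/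
theorem dense_of_splice {U : Set (Bool → ℕ → Bool)} (ψ : Bool → ℕ → Bool)
    (h : ∀ (B : Bool → ℕ → Bool) (m : ℕ), (fun i n => if n < m then B i n else ψ i n) ∈ U) : Dense U := by
  intro B
  refine mem_closure_of_tendsto
    (f := fun m i n => if n < m then B i n else ψ i n) (b := atTop) ?_ (.of_forall (h B))
  refine tendsto_pi_nhds.2 fun i => tendsto_pi_nhds.2 fun n => ?_
  refine tendsto_const_nhds.congr' ?_
  filter_upwards [eventually_gt_atTop n] with m hm
  rw [if_pos hm]

/-- The families `B` such that, for some `i`, an output of `Φ i` on the oracle constantly `i`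
with domain `E` differs from `B i`. -/
def wrongOn (Φ : Bool → TuringFunctional) (i : Bool) (E : Set ℕ) : Set (Bool → ℕ → Bool) :=
  {B | ∃ n b, (Φ i).HaltsP (constOracle i E) n b ∧ B i n ≠ b}

theorem isOpen_wrongOn (Φ : Bool → TuringFunctional) (i : Bool) (E : Set ℕ) :
    IsOpen (wrongOn Φ i E) := by
  simp only [wrongOn, Set.ofPred_exists]
  refine isOpen_iUnion fun n => isOpen_iUnion fun b => ?_
  refine isOpen_const.and ?_
  exact (isOpen_discrete {b}ᶜ).preimage (f := fun B : Bool → ℕ → Bool => B i n) (by fun_prop)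

theorem splice_mem_wrongOn {Φ : Bool → TuringFunctional} {i : Bool} {E : Set ℕ}
    {ψ : Bool → ℕ → Bool} (hψ : ∀ i E n b, (Φ i).HaltsP (constOracle i E) n b → ψ i n ≠ b)
    (hE : ((Φ i).PDomain (constOracle i E)).Infinite) (B : Bool → ℕ → Bool) (m : ℕ) :
    (fun i n => if n < m then B i n else ψ i n) ∈ wrongOn Φ i E := by
  obtain ⟨n, ⟨b, hb⟩, hn⟩ := hE.exists_gt m
  refine ⟨n, b, hb, ?_⟩
  simpa only [if_neg hn.not_gt] using hψ i E n b hb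

theorem isOpen_forall_exists_wrongOn (Φ : Bool → TuringFunctional) :
    IsOpen {B | ∀ A : ℕ → Bool, ∃ i, B ∈ wrongOn Φ i {x | A x = i}} := by
  have hW : IsOpen {q : (ℕ → Bool) × (Bool → ℕ → Bool) |
      ∃ i, q.2 ∈ wrongOn Φ i {x | q.1 x = i}} := by
    simp only [wrongOn, TuringFunctional.HaltsP, AgreesPart, mem_constOracle, Set.mem_ofPred_eq]
    simp only [Set.ofPred_exists]
    refine isOpen_iUnion fun i => isOpen_iUnion fun n => isOpen_iUnion fun b => IsOpen.and ?_ ?_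
    · simp only [Set.ofPred_exists]
      refine isOpen_iUnion fun k => isOpen_iUnion fun σ => isOpen_const.and ?_
      simp only [Set.ofPred_forall]
      refine σ.finite_toSet.isOpen_biInter fun p _ => IsOpen.and ?_ isOpen_const
      exact (isOpen_discrete {i}).preimage
        (f := fun q : (ℕ → Bool) × (Bool → ℕ → Bool) => q.1 p.1) (by fun_prop)
    · exact (isOpen_discrete {b}ᶜ).preimage
        (f := fun q : (ℕ → Bool) × (Bool → ℕ → Bool) => q.2 i n) (by fun_prop)
  rw [← isClosed_compl_iff]
  convert isClosedMap_snd_of_compactSpace _ hW.isClosed_compl using 1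
  ext B
  simp

/-- `Φ` witnesses that the set with characteristic function `B` is infinite-information
reducible to `A`. -/
def Reduces (Φ : TuringFunctional) (B : ℕ → Bool) (A : Set ℕ) : Prop :=
  ∀ g : ℕ →. Bool, IsPartialOracle g A → (pDom g).Infinite →
    Φ.PAgrees g {n | B n = true} ∧ (Φ.PDomain g).Infinite

theorem Reduces.constOracle {Φ : TuringFunctional} {B : ℕ → Bool} {A E : Set ℕ} {i : Bool}
    (h : Reduces Φ B A) (hA : ∀ n ∈ E, (i = true ↔ n ∈ A)) (hE : E.Infinite) :
    (∀ n b, Φ.HaltsP (constOracle i E) n b → B n = b) ∧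
      (Φ.PDomain (constOracle i E)).Infinite := by
  obtain ⟨h₁, h₂⟩ := h _ (isPartialOracle_constOracle hA) hE
  exact ⟨fun n b hb => (Bool.eq_iff_iff.2 (h₁ n b hb)).symm, h₂⟩

theorem not_reduces_of_mem_wrongOn {Φ : Bool → TuringFunctional} {B : Bool → ℕ → Bool}
    {A E : Set ℕ} {i : Bool} (hB : B ∈ wrongOn Φ i E) (hA : ∀ n ∈ E, (i = true ↔ n ∈ A)) :
    ¬ Reduces (Φ i) (B i) A := by
  obtain ⟨n, b, hb, hne⟩ := hB
  obtain ⟨k, σ, hk, hσ⟩ := hb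
  classical
  intro h
  refine hne (Bool.eq_iff_iff.2 ?_)
  have hg := h (fun n => Part.some (decide (n ∈ A)))
    (fun n b hb => by simp [Part.mem_some_iff.1 hb])
    (by simp [pDom, Set.infinite_univ])
  refine (hg.1 n b ⟨k, σ, hk, fun p hp => ?_⟩).symm
  obtain ⟨hp₁, hp₂⟩ := mem_constOracle.1 (hσ p hp)
  refine Part.mem_some_iff.2 (Bool.eq_iff_iff.2 ?_)
  simpa [← hp₂] using hA p.1 hp₁

theorem eventually_residual_not_reduces (Φ : Bool → TuringFunctional) :
    ∀ᶠ B in residual (Bool → ℕ → Bool), ∀ A, ¬ ∀ i, Reduces (Φ i) (B i) A := by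
  choose ψ hψ using fun i => (Φ i).exists_avoiding i
  by_cases H : ∀ i E, E.Infinite → ((Φ i).PDomain (constOracle i E)).Infinite
  · refine mem_of_superset (residual_of_dense_open (isOpen_forall_exists_wrongOn Φ) ?_) ?_
    · refine dense_of_splice ψ fun B m A => ?_
      obtain ⟨i, hi⟩ : ∃ i, {x | A x = i}.Infinite := by
        by_contra! hfin
        refine Set.infinite_univ (((hfin true).union (hfin false)).subset fun x _ => ?_)
        cases h : A x <;> simp [h]
      exact ⟨i, splice_mem_wrongOn hψ (H i _ hi) B m⟩
    · intro B hB A hA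
      classical
      obtain ⟨i, hi⟩ := hB fun n => decide (n ∈ A)
      refine not_reduces_of_mem_wrongOn hi (fun n hn => ?_) (hA i)
      have : decide (n ∈ A) = i := hn
      simp [← this]
  · push Not at H
    obtain ⟨i, E, hE, hfin⟩ := H
    have key : ∀ (B : Bool → ℕ → Bool) (A : Set ℕ), (∀ i, Reduces (Φ i) (B i) A) →
        ∃ k, ∀ n ∈ E ∩ Set.Ici k, ((!i) = true ↔ n ∈ A) := by
      intro B A hA
      by_contra! hk
      refine (((hA i).constOracle (E := {n ∈ E | i = true ↔ n ∈ A}) (fun n hn => hn.2) ?_).2.mono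
        ((Φ i).PDomain_constOracle_mono (Set.sep_subset _ _))) hfin
      refine Set.infinite_of_forall_exists_gt fun k => ?_
      obtain ⟨n, ⟨hn, hnk⟩, h⟩ := hk (k + 1)
      refine ⟨n, ⟨hn, ?_⟩, hnk⟩
      cases i <;> simp at h ⊢ <;> tauto
    have hEk : ∀ k, (E ∩ Set.Ici k).Infinite := fun k => by
      rw [← Set.compl_Iio]
      exact hE.sdiff (Set.finite_Iio k)
    by_cases H' : ∀ k, ((Φ !i).PDomain (constOracle (!i) (E ∩ Set.Ici k))).Infinite
    · have : ∀ᶠ B in residual _, ∀ k, B ∈ wrongOn Φ (!i) (E ∩ Set.Ici k) :=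
        eventually_countable_forall.2 fun k => residual_of_dense_open (isOpen_wrongOn _ _ _)
          (dense_of_splice ψ (splice_mem_wrongOn hψ (H' k)))
      filter_upwards [this] with B hB A hA
      obtain ⟨k, hk⟩ := key B A hA
      exact not_reduces_of_mem_wrongOn (hB k) hk (hA _)
    · push Not at H'
      obtain ⟨l, hl⟩ := H'
      refine .of_forall fun B A hA => ?_
      obtain ⟨k, hk⟩ := key B A hA
      refine (((hA (!i)).constOracle (fun n hn => hk n ⟨hn.1, ?_⟩) (hEk (max k l))).2.mono
        ((Φ (!i)).PDomain_constOracle_mono ?_)) hl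
      · exact (le_max_left k l).trans hn.2
      · exact Set.inter_subset_inter_right _ (Set.Ici_subset_Ici.2 (le_max_right k l))

theorem exists_maximal_pair_ii :
    ∃ B₀ B₁ : Set ℕ, ¬ ∃ A : Set ℕ, IIRed B₀ A ∧ IIRed B₁ A := by
  have h : ∀ᶠ B in residual (Bool → ℕ → Bool), ∀ Φ : Bool → TuringFunctional,
      ∀ A, ¬ ∀ i, Reduces (Φ i) (B i) A :=
    eventually_countable_forall.2 eventually_residual_not_reduces
  obtain ⟨B, hB⟩ := (dense_of_mem_residual h).nonempty
  refine ⟨{n | B false n = true}, {n | B true n = true}, ?_⟩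
  rintro ⟨A, ⟨Φ₀, h₀⟩, Φ₁, h₁⟩
  exact hB (fun i => cond i Φ₁ Φ₀) A (Bool.forall_bool.2 ⟨h₀, h₁⟩)
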